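/- For j < n ≤ N, assuming α ≠ 0, (a+c)_n ≠ 0, (a-c-j)_n ≠ 0, (a-c+1)_{n-j-1} ≠ 0 and (a+c+j+1)_{n-j-1} ≠ 0, the odd-case monic para-Racah polynomial admits the explicit expression P_n(y) = η_n · Σ_{k=0}^{N-n} [(-n)_k (n-N)_k / ((1)_k (-j)_k (a+c)_k (a-c-j)_k)] · Φ_k(y) + η_n · [(-n)_{j+1} (n-N)_{N-n} (1)_{n-j-1} / (α (1)_{j+1} (-j)_j (a+c)_{j+1} (a-c-j)_{j+1})] · Φ_{j+1}(y) · Σ_{m=0}^{n-j-1} [(-n+j+1)_m (n-j)_m / ((1)_m (j+2)_m (a+c+j+1)_m (a-c+1)_m)] · Ψ_m(y), where Φ_k(y) = Π_{l=0}^{k-1} ((a+l)² + y), Ψ_m(y) = Π_{l=0}^{m-1} ((a+j+1+l)² + y), and η_n = α (1)_n (-j)_j (1)_{n-j-1} (a+c)_n (a-c-j)_n / ((-n)_n (n-N)_{N-n} (1)_{2n-1-N}). -/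

import Mathlib

open Filter Topology Polynomial

noncomputable section

/-- The recurrence coefficient `bₙ` of the para-Racah polynomials, odd case `N = 2j+1`. -/
def bOdd (j : ℕ) (a c α : ℝ) (n : ℕ) : ℝ :=
  if n = j then
    -a ^ 2 - (j : ℝ) * (1 + a - c) * (1 + a + c + j) / 2 + α * (a - c) * (1 + (j : ℝ)) * (a + c + j)
  else if n = j + 1 then
    -a ^ 2 - (j : ℝ) * (1 + a - c) * (1 + a + c + j) / 2
      + (1 - α) * (a - c) * (1 + (j : ℝ)) * (a + c + j)
  else
    -(a * (a + j) + c * (c + j) + (n : ℝ) * ((2 * (j : ℝ) + 1) - n)) / 2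

/-- The recurrence coefficient `uₙ` of the para-Racah polynomials, odd case `N = 2j+1`. -/
def uOdd (j : ℕ) (a c α : ℝ) (n : ℕ) : ℝ :=
  if n = j + 1 then
    α * (1 - α) * (a - c) ^ 2 * (1 + (j : ℝ)) ^ 2 * (a + c + j) ^ 2
  else
    (n : ℝ) * ((2 * (j : ℝ) + 1) + 1 - n) * ((2 * (j : ℝ) + 1) - n + a + c) * ((n : ℝ) - 1 + a + c)
        * (((n : ℝ) - j - 1) ^ 2 - (a - c) ^ 2) /
      (4 * ((2 * (j : ℝ) + 1) - 2 * n) * ((2 * (j : ℝ) + 1) - 2 * n + 2))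

/-- Monic orthogonal polynomial sequence from a three-term recurrence:
`monicOPS b u n = (P_{n-1}, P_n)` with `P₋₁ = 0`, `P₀ = 1`,
`P_{n+1}(y) = (y - bₙ) Pₙ(y) - uₙ P_{n-1}(y)`. -/
def monicOPS (b u : ℕ → ℝ) : ℕ → Polynomial ℝ × Polynomial ℝ
  | 0 => (0, 1)
  | n + 1 =>
    ((monicOPS b u n).2,
      (X - C (b n)) * (monicOPS b u n).2 - C (u n) * (monicOPS b u n).1)

/-- The monic para-Racah polynomial `Pₙ`, odd case `N = 2j+1`. -/
def paraRacahOdd (j : ℕ) (a c α : ℝ) (n : ℕ) : Polynomial ℝ :=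
  (monicOPS (bOdd j a c α) (uOdd j a c α) n).2

/-- The Pochhammer symbol `(z)ₖ = z (z+1) ⋯ (z+k-1)`. -/
def poch (z : ℝ) (k : ℕ) : ℝ := ∏ i ∈ Finset.range k, (z + i)


theorem poch_zero (z : ℝ) : poch z 0 = 1 := by simp [poch]

theorem poch_succ (z : ℝ) (k : ℕ) : poch z (k + 1) = poch z k * (z + k) := by
  simp [poch, Finset.prod_range_succ]

theorem poch_succ' (z : ℝ) (k : ℕ) : poch z (k + 1) = z * poch (z + 1) k := by
  unfold poch
  rw [Finset.prod_range_succ', mul_comm]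
  simp only [Nat.cast_zero, add_zero, Nat.cast_add, Nat.cast_one]
  congr 1
  apply Finset.prod_congr rfl
  intros; ring

theorem poch_ne_of_le {z : ℝ} {k n : ℕ} (h : k ≤ n) (hn : poch z n ≠ 0) : poch z k ≠ 0 := by
  unfold poch at *
  rw [Finset.prod_ne_zero_iff] at *
  intro i hi
  exact hn i (Finset.mem_range.2 (lt_of_lt_of_le (Finset.mem_range.1 hi) h))

theorem poch_neg_zero {n k : ℕ} (h : n < k) : poch (-(n : ℝ)) k = 0 := by
  unfold poch
  exact Finset.prod_eq_zero (Finset.mem_range.2 h) (by simp)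

theorem poch_one (k : ℕ) : poch 1 k = (k.factorial : ℝ) := by
  induction k with
  | zero => simp [poch]
  | succ k ih => rw [poch_succ, ih, Nat.factorial_succ]; push_cast; ring

theorem poch_neg_self (k : ℕ) : poch (-(k : ℝ)) k = (-1) ^ k * (k.factorial : ℝ) := by
  induction k with
  | zero => simp [poch]
  | succ k ih =>
    rw [poch_succ']
    have : (-((k + 1 : ℕ) : ℝ) + 1) = -(k : ℝ) := by push_cast; ring
    rw [this, ih, Nat.factorial_succ]; push_cast; ring

theorem poch_neg_ne {j k : ℕ} (h : k ≤ j) : poch (-(j : ℝ)) k ≠ 0 := by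
  apply poch_ne_of_le h
  rw [poch_neg_self]
  positivity

theorem poch_pos {z : ℝ} (hz : 0 < z) (k : ℕ) : 0 < poch z k := by
  unfold poch
  exact Finset.prod_pos (fun i _ => by positivity)

theorem poch_add (z : ℝ) (k m : ℕ) : poch z (k + m) = poch z k * poch (z + k) m := by
  unfold poch
  rw [Finset.prod_range_add]
  congr 1
  apply Finset.prod_congr rfl
  intros; push_cast; ring

def cf (d e f g ν : ℝ) (k : ℕ) : ℝ :=
  poch (-ν) k * poch (ν + g) k / (poch 1 k * poch d k * poch e k * poch f k)

def Ph (a y : ℝ) (k : ℕ) : ℝ := ∏ l ∈ Finset.range k, ((a + l) ^ 2 + y)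

theorem Ph_succ (a y : ℝ) (k : ℕ) : Ph a y (k + 1) = Ph a y k * ((a + k) ^ 2 + y) := by
  simp [Ph, Finset.prod_range_succ]

theorem Ph_add (a y : ℝ) (k m : ℕ) : Ph a y (k + m) = Ph a y k * Ph (a + k) y m := by
  unfold Ph
  rw [Finset.prod_range_add]
  congr 1
  apply Finset.prod_congr rfl
  intros; push_cast; ring

def Sg (a d e f g y : ℝ) (K : ℕ) (ν : ℝ) : ℝ :=
  ∑ k ∈ Finset.range (K + 1), cf d e f g ν k * Ph a y k

theorem Sg_zero (a d e f g y ν : ℝ) : Sg a d e f g y 0 ν = 1 := by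
  simp [Sg, cf, Ph, poch_zero]

theorem Sg_succ (a d e f g y ν : ℝ) (K : ℕ) :
    Sg a d e f g y (K + 1) ν = Sg a d e f g y K ν + cf d e f g ν (K + 1) * Ph a y (K + 1) := by
  simp [Sg, Finset.sum_range_succ]

/-- first family: `g = 2d-1`. -/
def pA (e f g ν : ℝ) : ℝ := -(ν + e) * (ν + f) * (ν + g) / (2 * (2 * ν + g))
def rA (e f g ν : ℝ) : ℝ := -ν * (ν + g - e) * (ν + g - f) / (2 * (2 * ν + g))

/-- second family: `g = 1`. -/
def pB (d e f ν : ℝ) : ℝ := -(ν + d) * (ν + e) * (ν + f) / (2 * (2 * ν + 1))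
def rB (d e f ν : ℝ) : ℝ := -(ν + 1 - d) * (ν + 1 - e) * (ν + 1 - f) / (2 * (2 * ν + 1))

theorem shift_up (x g : ℝ) (k : ℕ) :
    poch (-(x + 1)) (k + 1) = -(x + 1) * poch (-x) k ∧
    poch (x + 1 + g) (k + 1) * (x + g) = poch (x + g) k * (x + g + k) * (x + g + k + 1) := by
  constructor
  · rw [poch_succ']; congr 2; ring
  · have h1 := poch_succ' (x + g) (k + 1)
    rw [poch_succ, poch_succ] at h1
    have : x + 1 + g = x + g + 1 := by ring
    rw [this]
    push_cast at h1
    linear_combination -h1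

theorem shift_down (x g : ℝ) (k : ℕ) :
    poch (-(x - 1)) (k + 1) * x = -(poch (-x) k * (-x + k) * (-x + k + 1)) ∧
    poch (x - 1 + g) (k + 1) = (x - 1 + g) * poch (x + g) k := by
  constructor
  · have h1 := poch_succ' (-x) (k + 1)
    rw [poch_succ, poch_succ] at h1
    have : -(x - 1) = -x + 1 := by ring
    rw [this]
    push_cast at h1
    linear_combination h1
  · rw [poch_succ']; congr 2; ring

theorem cf_prev {d e f g ν : ℝ} {K : ℕ} (hd : poch d (K + 1) ≠ 0) (he : poch e (K + 1) ≠ 0)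
    (hf : poch f (K + 1) ≠ 0) :
    cf d e f g ν K = poch (-ν) K * poch (ν + g) K * ((K + 1) * (d + K) * (e + K) * (f + K)) /
      (poch 1 (K + 1) * poch d (K + 1) * poch e (K + 1) * poch f (K + 1)) := by
  have h1 : poch 1 (K + 1) ≠ 0 := (poch_pos one_pos _).ne'
  unfold cf
  rw [poch_succ] at h1 hd he hf
  rw [poch_succ 1, poch_succ d, poch_succ e, poch_succ f]
  have h1' := mul_ne_zero_iff.1 h1
  have hd' := mul_ne_zero_iff.1 hd
  have he' := mul_ne_zero_iff.1 he
  have hf' := mul_ne_zero_iff.1 hf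
  obtain ⟨_, _⟩ := h1'
  obtain ⟨_, _⟩ := hd'
  obtain ⟨_, _⟩ := he'
  obtain ⟨_, _⟩ := hf'
  rw [div_eq_div_iff (by simp_all) (by simp_all)]
  ring

theorem recA (a d e f g y ν : ℝ) (hg : g = 2 * d - 1) (hs : e + f = d + 2 * a)
    (hν : 2 * ν + g ≠ 0) (K : ℕ) (hd : poch d K ≠ 0) (he : poch e K ≠ 0) (hf : poch f K ≠ 0) :
    y * Sg a d e f g y K ν = pA e f g ν * Sg a d e f g y K (ν + 1)
      + (-a ^ 2 - pA e f g ν - rA e f g ν) * Sg a d e f g y K ν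
      + rA e f g ν * Sg a d e f g y K (ν - 1) + cf d e f g ν K * Ph a y (K + 1) := by
  induction K with
  | zero => simp only [Sg_zero]; simp [Ph, cf, poch_zero]; ring
  | succ K ih =>
    have ih := ih (poch_ne_of_le (Nat.le_succ _) hd) (poch_ne_of_le (Nat.le_succ _) he)
      (poch_ne_of_le (Nat.le_succ _) hf)
    have key : cf d e f g ν K - (a + (K + 1)) ^ 2 * cf d e f g ν (K + 1) =
        pA e f g ν * cf d e f g (ν + 1) (K + 1)
      + (-a ^ 2 - pA e f g ν - rA e f g ν) * cf d e f g ν (K + 1)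
      + rA e f g ν * cf d e f g (ν - 1) (K + 1) := by
      rw [cf_prev hd he hf]
      unfold cf
      generalize poch 1 (K + 1) * poch d (K + 1) * poch e (K + 1) * poch f (K + 1) = Z
      obtain ⟨u1, u2⟩ := shift_up ν g K
      obtain ⟨w1, w2⟩ := shift_down ν g K
      have hp : pA e f g ν * (poch (-(ν + 1)) (K + 1) * poch (ν + 1 + g) (K + 1)) =
          -(ν + e) * (ν + f) / (2 * (2 * ν + g)) * (-(ν + 1) * poch (-ν) K) *
          (poch (ν + g) K * (ν + g + K) * (ν + g + K + 1)) := by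
        rw [u1, ← u2, pA]; ring
      have hr : rA e f g ν * (poch (-(ν - 1)) (K + 1) * poch (ν - 1 + g) (K + 1)) =
          -(ν + g - e) * (ν + g - f) / (2 * (2 * ν + g)) *
          (-(poch (-ν) K * (-ν + K) * (-ν + K + 1))) * ((ν - 1 + g) * poch (ν + g) K) := by
        rw [w2, ← w1, rA]; ring
      simp only [mul_div_assoc']
      rw [hp, hr, poch_succ (-ν), poch_succ (ν + g)]
      generalize poch (-ν) K = A
      generalize poch (ν + g) K = B
      simp only [← add_div, ← sub_div]
      congr 1
      unfold pA rA
      have hdg : d = (g + 1) / 2 := by linarith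
      have haa : a = (e + f - (g + 1) / 2) / 2 := by linarith
      rw [hdg, haa]
      clear * - hν
      field_simp
      ring
    simp only [Sg_succ, Ph_succ a y (K + 1)]
    push_cast
    linear_combination ih + Ph a y (K + 1) * key

theorem recB (a d e f y ν : ℝ) (hs : d + e + f = 2 + 2 * a)
    (hν : 2 * ν + 1 ≠ 0) (K : ℕ) (hd : poch d K ≠ 0) (he : poch e K ≠ 0) (hf : poch f K ≠ 0) :
    y * Sg a d e f 1 y K ν = pB d e f ν * Sg a d e f 1 y K (ν + 1)
      + (-a ^ 2 - pB d e f ν - rB d e f ν) * Sg a d e f 1 y K ν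
      + rB d e f ν * Sg a d e f 1 y K (ν - 1) + cf d e f 1 ν K * Ph a y (K + 1) := by
  induction K with
  | zero => simp only [Sg_zero]; simp [Ph, cf, poch_zero]; ring
  | succ K ih =>
    have ih := ih (poch_ne_of_le (Nat.le_succ _) hd) (poch_ne_of_le (Nat.le_succ _) he)
      (poch_ne_of_le (Nat.le_succ _) hf)
    have key : cf d e f 1 ν K - (a + (K + 1)) ^ 2 * cf d e f 1 ν (K + 1) =
        pB d e f ν * cf d e f 1 (ν + 1) (K + 1)
      + (-a ^ 2 - pB d e f ν - rB d e f ν) * cf d e f 1 ν (K + 1)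
      + rB d e f ν * cf d e f 1 (ν - 1) (K + 1) := by
      rw [cf_prev hd he hf]
      unfold cf
      generalize poch 1 (K + 1) * poch d (K + 1) * poch e (K + 1) * poch f (K + 1) = Z
      obtain ⟨u1, u2⟩ := shift_up ν 1 K
      obtain ⟨w1, w2⟩ := shift_down ν 1 K
      have hp : poch (-(ν + 1)) (K + 1) * poch (ν + 1 + 1) (K + 1) =
          -(poch (-ν) K) * (poch (ν + 1) K * (ν + 1 + K) * (ν + 1 + K + 1)) := by
        rw [u1]; linear_combination (-poch (-ν) K) * u2
      have hr : poch (-(ν - 1)) (K + 1) * poch (ν - 1 + 1) (K + 1) =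
          (-(poch (-ν) K * (-ν + K) * (-ν + K + 1))) * poch (ν + 1) K := by
        rw [w2]; linear_combination (poch (ν + 1) K) * w1
      simp only [mul_div_assoc']
      rw [hp, hr, poch_succ (-ν), poch_succ (ν + 1)]
      generalize poch (-ν) K = A
      generalize poch (ν + 1) K = B
      simp only [← add_div, ← sub_div]
      congr 1
      unfold pB rB
      have : a = (d + e + f - 2) / 2 := by linarith
      subst this
      field_simp
      ring
    simp only [Sg_succ, Ph_succ a y (K + 1)]
    push_cast
    linear_combination ih + Ph a y (K + 1) * key

theorem cf_symm (d e f g ν μ : ℝ) (h : μ = -g - ν) (k : ℕ) : cf d e f g μ k = cf d e f g ν k := by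
  subst h
  unfold cf
  have h1 : -(-g - ν) = ν + g := by ring
  have h2 : -g - ν + g = -ν := by ring
  rw [h1, h2, mul_comm (poch (ν + g) k)]

theorem Sg_symm (a d e f g y ν μ : ℝ) (h : μ = -g - ν) (K : ℕ) :
    Sg a d e f g y K μ = Sg a d e f g y K ν := by
  unfold Sg
  apply Finset.sum_congr rfl
  intro k _
  rw [cf_symm d e f g ν μ h]

theorem Sg_ext (a d e f g y ν : ℝ) (m t : ℕ) (h : ∀ k, m < k → cf d e f g ν k = 0) :
    Sg a d e f g y (m + t) ν = Sg a d e f g y m ν := by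
  induction t with
  | zero => rfl
  | succ t ih => rw [← add_assoc, Sg_succ, ih, h _ (by omega)]; ring

theorem cf_zero_left (d e f g : ℝ) {n k : ℕ} (h : n < k) : cf d e f g (n : ℝ) k = 0 := by
  unfold cf
  rw [poch_neg_zero h]; simp

def Sl (j : ℕ) (a c y ν : ℝ) : ℝ := Sg a (-(j : ℝ)) (a + c) (a - c - j) (-(2 * j + 1)) y j ν
def pl (j : ℕ) (a c ν : ℝ) : ℝ := pA (a + c) (a - c - j) (-(2 * j + 1)) ν
def rl (j : ℕ) (a c ν : ℝ) : ℝ := rA (a + c) (a - c - j) (-(2 * j + 1)) ν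
def Tl (j : ℕ) (a c y : ℝ) (K : ℕ) (ν : ℝ) : ℝ :=
  Sg (a + j + 1) ((j : ℝ) + 2) (a + c + j + 1) (a - c + 1) 1 y K ν
def ph (j : ℕ) (a c ν : ℝ) : ℝ := pB ((j : ℝ) + 2) (a + c + j + 1) (a - c + 1) ν
def rh (j : ℕ) (a c ν : ℝ) : ℝ := rB ((j : ℝ) + 2) (a + c + j + 1) (a - c + 1) ν

theorem odd_ne (n j : ℕ) : 2 * (n : ℝ) + -(2 * j + 1) ≠ 0 := by
  intro h
  have h' : (2 * (n : ℤ) + -(2 * j + 1) : ℤ) = 0 := by exact_mod_cast h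
  omega

theorem Sl_rec (j : ℕ) (a c y : ℝ) (n : ℕ) (he : poch (a + c) j ≠ 0)
    (hf : poch (a - c - j) j ≠ 0) :
    y * Sl j a c y n = pl j a c n * Sl j a c y (n + 1)
      + (-a ^ 2 - pl j a c n - rl j a c n) * Sl j a c y n + rl j a c n * Sl j a c y (n - 1)
      + cf (-(j : ℝ)) (a + c) (a - c - j) (-(2 * j + 1)) n j * Ph a y (j + 1) :=
  recA a _ _ _ _ y n (by ring) (by ring) (odd_ne n j) j (poch_neg_ne le_rfl) he hf

theorem Tl_rec (j : ℕ) (a c y : ℝ) (m K : ℕ) (hK : m < K) (he : poch (a + c + j + 1) K ≠ 0)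
    (hf : poch (a - c + 1) K ≠ 0) :
    y * Tl j a c y K m = ph j a c m * Tl j a c y K (m + 1)
      + (-(a + j + 1) ^ 2 - ph j a c m - rh j a c m) * Tl j a c y K m
      + rh j a c m * Tl j a c y K (m - 1) := by
  have h := recB (a + j + 1) ((j : ℝ) + 2) (a + c + j + 1) (a - c + 1) y m (by ring)
    (by positivity) K (poch_pos (by positivity) K).ne' he hf
  rw [cf_zero_left _ _ _ _ hK, zero_mul, add_zero] at h
  exact h

theorem u_low (j : ℕ) (a c α : ℝ) (n : ℕ) (h : n ≠ j) :
    uOdd j a c α (n + 1) = pl j a c n * rl j a c (n + 1) := by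
  have h1 := odd_ne n j
  have h2 := odd_ne (n + 1) j
  unfold uOdd pl rl pA rA
  rw [if_neg (by omega)]
  push_cast at *
  have h3 : 2 * (j : ℝ) + 1 - 2 * (n + 1) ≠ 0 := fun h => h2 (by linarith)
  have h4 : 2 * (j : ℝ) + 1 - 2 * (n + 1) + 2 ≠ 0 := fun h => h1 (by linarith)
  rw [div_mul_div_comm, div_eq_div_iff (by positivity) (by positivity)]
  ring

theorem b_low (j : ℕ) (a c α : ℝ) (n : ℕ) (h : n ≠ j) (h' : n ≠ j + 1) :
    bOdd j a c α n = -a ^ 2 - pl j a c n - rl j a c n := by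
  have h1 := odd_ne n j
  unfold bOdd pl rl pA rA
  rw [if_neg h, if_neg h']
  generalize (n : ℝ) = x at *
  generalize (j : ℝ) = z at *
  generalize hw : 2 * x + -(2 * z + 1) = w at *
  have hx : x = (w + 2 * z + 1) / 2 := by linarith
  subst hx
  field_simp
  ring

theorem u_high (j : ℕ) (a c α : ℝ) (m : ℕ) :
    uOdd j a c α (j + 1 + (m + 1)) = ph j a c m * rh j a c (m + 1) := by
  have h1 : 2 * (m : ℝ) + 1 ≠ 0 := by positivity
  have h2 : 2 * ((m : ℝ) + 1) + 1 ≠ 0 := by positivity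
  unfold uOdd ph rh pB rB
  rw [if_neg (by omega)]
  push_cast at *
  have h3 : 2 * (j : ℝ) + 1 - 2 * (j + 1 + (m + 1)) ≠ 0 := fun h => h2 (by linarith)
  have h4 : 2 * (j : ℝ) + 1 - 2 * (j + 1 + (m + 1)) + 2 ≠ 0 := fun h => h1 (by linarith)
  rw [div_mul_div_comm, div_eq_div_iff (by positivity) (by positivity)]
  ring

theorem b_high (j : ℕ) (a c α : ℝ) (m : ℕ) :
    bOdd j a c α (j + 1 + (m + 1)) =
      -(a + j + 1) ^ 2 - ph j a c (m + 1) - rh j a c (m + 1) := by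
  have h2 : 2 * ((m : ℝ) + 1) + 1 ≠ 0 := by positivity
  unfold bOdd ph rh pB rB
  rw [if_neg (by omega), if_neg (by omega)]
  push_cast
  generalize (m : ℝ) = x at *
  generalize hw : 2 * (x + 1) + 1 = w at *
  have hx : x = (w - 3) / 2 := by linarith
  subst hx
  field_simp
  ring

def Pv (j : ℕ) (a c α y : ℝ) (n : ℕ) : ℝ := (paraRacahOdd j a c α n).eval y
def Qv (j : ℕ) (a c α y : ℝ) (n : ℕ) : ℝ :=
  (monicOPS (bOdd j a c α) (uOdd j a c α) n).1.eval y

theorem Pv_succ (j : ℕ) (a c α y : ℝ) (n : ℕ) : Pv j a c α y (n + 1) =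
    (y - bOdd j a c α n) * Pv j a c α y n - uOdd j a c α n * Qv j a c α y n := by
  simp [Pv, Qv, paraRacahOdd, monicOPS]

theorem Qv_succ (j : ℕ) (a c α y : ℝ) (n : ℕ) : Qv j a c α y (n + 1) = Pv j a c α y n := by
  simp [Pv, Qv, paraRacahOdd, monicOPS]

def et (j : ℕ) (a c : ℝ) (n : ℕ) : ℝ := ∏ i ∈ Finset.range n, pl j a c i

theorem et_succ (j : ℕ) (a c : ℝ) (n : ℕ) : et j a c (n + 1) = et j a c n * pl j a c n := by
  simp [et, Finset.prod_range_succ]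

theorem low (j : ℕ) (a c α y : ℝ) (n : ℕ) (hn : n ≤ j) (he : poch (a + c) j ≠ 0)
    (hf : poch (a - c - j) j ≠ 0) :
    Pv j a c α y n = et j a c n * Sl j a c y n ∧
    uOdd j a c α n * Qv j a c α y n = rl j a c n * et j a c n * Sl j a c y (n - 1) := by
  induction n with
  | zero =>
    constructor
    · have : Sl j a c y ((0 : ℕ) : ℝ) = 1 := by
        have := Sg_ext a (-(j : ℝ)) (a + c) (a - c - j) (-(2 * j + 1)) y ((0 : ℕ) : ℝ) 0 j
          (fun k hk => cf_zero_left _ _ _ _ hk)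
        rw [zero_add, Sg_zero] at this
        exact this
      rw [this]
      simp [Pv, paraRacahOdd, monicOPS, et]
    · simp [Qv, monicOPS, rl, rA]
  | succ n ih =>
    obtain ⟨i1, i2⟩ := ih (by omega)
    have hr := Sl_rec j a c y n he hf
    rw [cf_zero_left _ _ _ _ (show n < j by omega)] at hr
    constructor
    · rw [Pv_succ, i2, i1, b_low j a c α n (by omega) (by omega), et_succ]
      push_cast
      linear_combination (et j a c n) * hr
    · rw [Qv_succ, i1, u_low j a c α n (by omega), et_succ]
      push_cast
      rw [add_sub_cancel_right]
      ring

theorem et_eq (j : ℕ) (a c : ℝ) (n : ℕ) (hn : n ≤ j) :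
    et j a c n * (poch (-(n : ℝ)) n * poch (n + -(2 * j + 1)) n) =
      poch 1 n * poch (-(j : ℝ)) n * poch (a + c) n * poch (a - c - j) n := by
  induction n with
  | zero => simp [et, poch_zero]
  | succ n ih =>
    have ih := ih (by omega)
    have h1 := odd_ne n j
    obtain ⟨u1, u2⟩ := shift_up (n : ℝ) (-(2 * j + 1)) n
    rw [et_succ, poch_succ 1, poch_succ (-(j : ℝ)), poch_succ (a + c), poch_succ (a - c - j)]
    push_cast
    rw [u1]
    have hp : pl j a c n * poch (n + 1 + -(2 * j + 1)) (n + 1) =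
        -(n + (a + c)) * (n + (a - c - j)) / (2 * (2 * n + -(2 * j + 1))) *
        (poch (n + -(2 * j + 1)) n * (n + -(2 * j + 1) + n) * (n + -(2 * j + 1) + n + 1)) := by
      rw [← u2, pl, pA]; ring
    have hq : -(n + (a + c)) * (n + (a - c - j)) / (2 * (2 * n + -(2 * j + 1))) *
        ((n + -(2 * j + 1) + n) * (n + -(2 * j + 1) + n + 1)) =
        -((n + (a + c)) * (n + (a - c - j)) * (n - j) ) := by
      have h3 : (n : ℝ) + -(2 * j + 1) + n = 2 * n + -(2 * j + 1) := by ring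
      rw [h3]
      generalize hw : 2 * (n : ℝ) + -(2 * j + 1) = w at *
      have : w + 1 = 2 * ((n : ℝ) - j) := by rw [← hw]; ring
      rw [this]
      field_simp
    linear_combination (-(n + 1) * et j a c n * poch (-(n : ℝ)) n) * hp +
      (-(n + 1) * et j a c n * poch (-(n : ℝ)) n * poch (n + -(2 * j + 1)) n) * hq +
      ((n + 1) * ((n + (a + c)) * (n + (a - c - j)) * (n - j) )) * ih

/-- The two descriptions of the leading coefficient at `n = j`. -/
theorem et_cf (j : ℕ) (a c : ℝ) (he : poch (a + c) j ≠ 0) (hf : poch (a - c - j) j ≠ 0) :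
    et j a c j * cf (-(j : ℝ)) (a + c) (a - c - j) (-(2 * j + 1)) j j = 1 := by
  have h := et_eq j a c j le_rfl
  have h1 : poch 1 j ≠ 0 := (poch_pos one_pos _).ne'
  have h2 : poch (-(j : ℝ)) j ≠ 0 := poch_neg_ne le_rfl
  unfold cf
  rw [mul_div_assoc', h]
  exact div_self (by positivity)

theorem poch_top (j : ℕ) : poch ((j : ℝ) + -(2 * j + 1)) j = (-1) ^ j * ((j + 1).factorial : ℝ) := by
  have h := poch_neg_self (j + 1)
  rw [poch_succ] at h
  have e1 : (j : ℝ) + -(2 * j + 1) = -((j + 1 : ℕ) : ℝ) := by push_cast; ring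
  rw [e1]
  have e2 : -((j + 1 : ℕ) : ℝ) + j = -1 := by push_cast; ring
  rw [e2, pow_succ] at h
  linarith

theorem et_top (j : ℕ) (a c : ℝ) :
    et j a c j * (j + 1) = (-1) ^ j * poch (a + c) j * poch (a - c - j) j := by
  have h := et_eq j a c j le_rfl
  rw [poch_top, poch_one, Nat.factorial_succ, poch_neg_self] at h
  have h0 : (j.factorial : ℝ) ≠ 0 := by positivity
  have hs : ((-1 : ℝ) ^ j) * (-1) ^ j = 1 := by rw [← mul_pow]; simp
  push_cast at h
  have : (j.factorial : ℝ) * j.factorial * (et j a c j * (j + 1)) =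
    j.factorial * j.factorial * ((-1) ^ j * poch (a + c) j * poch (a - c - j) j) := by
    linear_combination h - (et j a c j * j.factorial * ((j + 1) * j.factorial)) * hs
  exact mul_left_cancel₀ (mul_ne_zero h0 h0) this

def H0 (j : ℕ) (a c α : ℝ) : ℝ := -(α * ((a - c) * (1 + (j : ℝ)) * (a + c + j))) * et j a c j

def Hm (j : ℕ) (a c α : ℝ) (m : ℕ) : ℝ :=
  H0 j a c α * ∏ i ∈ Finset.range m, pl j a c ((j + 1 + i : ℕ) : ℝ)

def Zm (j : ℕ) (a c : ℝ) (m : ℕ) : ℝ := ∏ i ∈ Finset.range m, ph j a c i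

theorem Hm_succ (j : ℕ) (a c α : ℝ) (m : ℕ) :
    Hm j a c α (m + 1) = Hm j a c α m * pl j a c ((j + 1 + m : ℕ) : ℝ) := by
  simp [Hm, Finset.prod_range_succ, mul_assoc]

theorem Zm_succ (j : ℕ) (a c : ℝ) (m : ℕ) :
    Zm j a c (m + 1) = Zm j a c m * ph j a c m := by
  simp [Zm, Finset.prod_range_succ]

theorem Sl_symm (j : ℕ) (a c y : ℝ) : Sl j a c y ((j + 1 : ℕ) : ℝ) = Sl j a c y j :=
  Sg_symm _ _ _ _ _ _ _ _ (by push_cast; ring) _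

theorem Pv_j1 (j : ℕ) (a c α y : ℝ) (he : poch (a + c) j ≠ 0)
    (hf : poch (a - c - j) j ≠ 0) :
    Pv j a c α y (j + 1) = H0 j a c α * Sl j a c y j + Ph a y (j + 1) := by
  obtain ⟨i1, i2⟩ := low j a c α y j le_rfl he hf
  have hr := Sl_rec j a c y j he hf
  have hs := Sl_symm j a c y
  push_cast at hs
  rw [hs] at hr
  have hc := et_cf j a c he hf
  have hb : bOdd j a c α j =
      -a ^ 2 - rl j a c j + α * ((a - c) * (1 + (j : ℝ)) * (a + c + j)) := by
    unfold bOdd rl rA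
    rw [if_pos rfl]
    have : 2 * (j : ℝ) + -(2 * j + 1) = -1 := by ring
    rw [this]
    ring
  rw [Pv_succ, i2, i1, hb, H0]
  linear_combination et j a c j * hr + Ph a y (j + 1) * hc

theorem Tl_ext (j : ℕ) (a c y : ℝ) (m t : ℕ) : Tl j a c y (m + t) m = Tl j a c y m m :=
  Sg_ext _ _ _ _ _ _ _ _ _ (fun _ hk => cf_zero_left _ _ _ _ hk)

theorem Pv_j2 (j : ℕ) (a c α y : ℝ) (he : poch (a + c) j ≠ 0)
    (hf : poch (a - c - j) j ≠ 0) (he' : poch (a + c + j + 1) 1 ≠ 0)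
    (hf' : poch (a - c + 1) 1 ≠ 0) :
    Pv j a c α y (j + 2) = H0 j a c α * pl j a c ((j + 1 : ℕ) : ℝ) * Sl j a c y ((j + 2 : ℕ) : ℝ)
      + Ph a y (j + 1) * (ph j a c 0 * Tl j a c y 1 1) := by
  obtain ⟨i1, i2⟩ := low j a c α y j le_rfl he hf
  have i3 := Pv_j1 j a c α y he hf
  have hr := Sl_rec j a c y (j + 1) he hf
  have hs := Sl_symm j a c y
  rw [hs] at hr
  have e1 : ((j + 1 : ℕ) : ℝ) - 1 = j := by push_cast; ring
  have e2 : ((j + 1 : ℕ) : ℝ) + 1 = ((j + 2 : ℕ) : ℝ) := by push_cast; ring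
  rw [e1, e2] at hr
  rw [cf_symm _ _ _ _ (j : ℝ) ((j + 1 : ℕ) : ℝ) (by push_cast; ring)] at hr
  have hc := et_cf j a c he hf
  have hp : pl j a c ((j + 1 : ℕ) : ℝ) =
      (j : ℝ) * (1 + a - c) * (1 + a + c + j) / 2 := by
    unfold pl pA
    have : 2 * ((j + 1 : ℕ) : ℝ) + -(2 * j + 1) = 1 := by push_cast; ring
    rw [this]
    push_cast
    ring
  have hb : bOdd j a c α (j + 1) =
      -a ^ 2 - pl j a c ((j + 1 : ℕ) : ℝ) + (1 - α) * ((a - c) * (1 + (j : ℝ)) * (a + c + j)) := by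
    rw [hp]
    unfold bOdd
    rw [if_neg (by omega), if_pos rfl]
    ring
  have hu : uOdd j a c α (j + 1) = α * (1 - α) * ((a - c) * (1 + (j : ℝ)) * (a + c + j)) ^ 2 := by
    unfold uOdd
    rw [if_pos rfl]; ring
  have ht := Tl_rec j a c y 0 1 one_pos he' hf'
  have t0 : Tl j a c y 1 ((0 : ℕ) : ℝ) = 1 := by
    have := Tl_ext j a c y 0 1
    rw [zero_add] at this
    rw [this]; exact Sg_zero _ _ _ _ _ _ _
  have t1 : Tl j a c y 1 (((0 : ℕ) : ℝ) - 1) = 1 := by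
    refine Eq.trans ?_ t0
    exact Sg_symm _ _ _ _ _ _ _ _ (by push_cast; ring) _
  rw [t0, t1] at ht
  simp only [Nat.cast_zero, zero_add] at ht
  have hph : ph j a c 0 = a ^ 2 + pl j a c ((j + 1 : ℕ) : ℝ)
      - (a - c) * (1 + (j : ℝ)) * (a + c + j) - (a + j + 1) ^ 2 := by
    rw [hp]; unfold ph pB; ring
  rw [Pv_succ, Qv_succ, i1, i3, hb, hu]
  have hH' : H0 j a c α = -(α * ((a - c) * (1 + (j : ℝ)) * (a + c + j))) * et j a c j := rfl
  generalize (a - c) * (1 + (j : ℝ)) * (a + c + j) = W at *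
  have hH : H0 j a c α * cf (-(j : ℝ)) (a + c) (a - c - j) (-(2 * j + 1)) j j = -(α * W) := by
    rw [hH', mul_assoc, hc, mul_one]
  linear_combination H0 j a c α * hr + Ph a y (j + 1) * ht + Ph a y (j + 1) * hH
    - Ph a y (j + 1) * hph - (1 - α) * W * Sl j a c y j * hH'

theorem high (j : ℕ) (a c α y : ℝ) (he : poch (a + c) j ≠ 0)
    (hf : poch (a - c - j) j ≠ 0) (m : ℕ) (hm : m + 1 ≤ j)
    (he' : poch (a + c + j + 1) (m + 1) ≠ 0) (hf' : poch (a - c + 1) (m + 1) ≠ 0) :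
    (Pv j a c α y (j + 1 + m) = Hm j a c α m * Sl j a c y ((j + 1 + m : ℕ) : ℝ) +
      Zm j a c m * Ph a y (j + 1) * Tl j a c y m m) ∧
    (Pv j a c α y (j + 1 + (m + 1)) =
      Hm j a c α (m + 1) * Sl j a c y ((j + 1 + (m + 1) : ℕ) : ℝ) +
      Zm j a c (m + 1) * Ph a y (j + 1) * Tl j a c y (m + 1) ((m + 1 : ℕ) : ℝ)) := by
  induction m with
  | zero =>
    constructor
    · have h := Pv_j1 j a c α y he hf
      rw [← Sl_symm] at h
      have t0 : Tl j a c y 0 ((0 : ℕ) : ℝ) = 1 := Sg_zero _ _ _ _ _ _ _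
      rw [t0]
      simpa [Hm, Zm] using h
    · have h := Pv_j2 j a c α y he hf he' hf'
      rw [Hm_succ, Zm_succ]
      rw [show j + 1 + (0 + 1) = j + 2 by omega, h]
      simp [Hm, Zm]
      ring
  | succ m ih =>
    obtain ⟨i1, i2⟩ := ih (by omega) (poch_ne_of_le (Nat.le_succ _) he')
      (poch_ne_of_le (Nat.le_succ _) hf')
    refine ⟨i2, ?_⟩
    have hr := Sl_rec j a c y (j + 1 + (m + 1)) he hf
    have hz : cf (-(j : ℝ)) (a + c) (a - c - j) (-(2 * j + 1)) ((j + 1 + (m + 1) : ℕ) : ℝ) j = 0 := by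
      obtain ⟨i, rfl⟩ : ∃ i, j = m + 1 + i := ⟨j - (m + 1), by omega⟩
      rw [cf_symm _ _ _ _ (i : ℝ) _ (by push_cast; ring)]
      exact cf_zero_left _ _ _ _ (by omega)
    rw [hz] at hr
    have ht := Tl_rec j a c y (m + 1) (m + 1 + 1) (by omega) he' hf'
    have e1 : ((j + 1 + (m + 1) : ℕ) : ℝ) - 1 = ((j + 1 + m : ℕ) : ℝ) := by push_cast; ring
    have e2 : ((j + 1 + (m + 1) : ℕ) : ℝ) + 1 = ((j + 1 + (m + 1 + 1) : ℕ) : ℝ) := by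
      push_cast; ring
    have e3 : ((m + 1 : ℕ) : ℝ) - 1 = (m : ℝ) := by push_cast; ring
    have e4 : ((m + 1 : ℕ) : ℝ) + 1 = ((m + 1 + 1 : ℕ) : ℝ) := by push_cast; ring
    rw [e1, e2] at hr
    rw [e3, e4, Tl_ext j a c y (m + 1) 1,
      show m + 1 + 1 = m + 2 from rfl, Tl_ext j a c y m 2] at ht
    have hb1 := b_low j a c α (j + 1 + (m + 1)) (by omega) (by omega)
    have hb2 := b_high j a c α m
    have hu1 := u_low j a c α (j + 1 + m) (by omega)
    have hu2 := u_high j a c α m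
    have e5 : ((j + 1 + m : ℕ) : ℝ) + 1 = ((j + 1 + (m + 1) : ℕ) : ℝ) := by push_cast; ring
    have e6 : (m : ℝ) + 1 = ((m + 1 : ℕ) : ℝ) := by push_cast; ring
    rw [e5, show j + 1 + m + 1 = j + 1 + (m + 1) by omega] at hu1
    rw [e6] at hb2 hu2
    have hP := Pv_succ j a c α y (j + 1 + (m + 1))
    rw [show Qv j a c α y (j + 1 + (m + 1)) = Pv j a c α y (j + 1 + m) from
      Qv_succ j a c α y (j + 1 + m), i1, i2] at hP
    rw [show j + 1 + (m + 1 + 1) = j + 1 + (m + 1) + 1 by omega, hP]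
    rw [show j + 1 + (m + 1 + 1) = j + 1 + (m + 1) + 1 by omega] at hr
    rw [Hm_succ j a c α (m + 1), Zm_succ j a c (m + 1)]
    rw [show m + 1 + 1 = m + 2 from rfl] at *
    have hH := Hm_succ j a c α m
    have hZ := Zm_succ j a c m
    generalize Hm j a c α (m + 1) = H1 at *
    generalize Hm j a c α m = H at *
    generalize Zm j a c (m + 1) = Z1 at *
    generalize Zm j a c m = Z at *
    generalize Sl j a c y ((j + 1 + (m + 1) + 1 : ℕ) : ℝ) = S2 at *
    generalize Sl j a c y ((j + 1 + (m + 1) : ℕ) : ℝ) = S1 at *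
    generalize Sl j a c y ((j + 1 + m : ℕ) : ℝ) = S at *
    generalize Tl j a c y (m + 2) ((m + 2 : ℕ) : ℝ) = T2 at *
    generalize Tl j a c y (m + 1) ((m + 1 : ℕ) : ℝ) = T1 at *
    generalize Tl j a c y m m = T at *
    generalize bOdd j a c α (j + 1 + (m + 1)) = b at *
    generalize uOdd j a c α (j + 1 + (m + 1)) = u at *
    linear_combination H1 * hr - H1 * S1 * hb1 - Z1 * Ph a y (j + 1) * T1 * hb2 +
      Z1 * Ph a y (j + 1) * ht - H * S * hu1 - Z * Ph a y (j + 1) * T * hu2 +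
      rl j a c ((j + 1 + (m + 1) : ℕ) : ℝ) * S * hH +
      rh j a c ((m + 1 : ℕ) : ℝ) * Ph a y (j + 1) * T * hZ

theorem high_all (j : ℕ) (a c α y : ℝ) (he : poch (a + c) j ≠ 0)
    (hf : poch (a - c - j) j ≠ 0) (m : ℕ) (hm : m ≤ j)
    (he' : poch (a + c + j + 1) m ≠ 0) (hf' : poch (a - c + 1) m ≠ 0) :
    Pv j a c α y (j + 1 + m) = Hm j a c α m * Sl j a c y ((j + 1 + m : ℕ) : ℝ) +
      Zm j a c m * Ph a y (j + 1) * Tl j a c y m m := by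
  cases m with
  | zero =>
    have h := Pv_j1 j a c α y he hf
    rw [← Sl_symm] at h
    have t0 : Tl j a c y 0 ((0 : ℕ) : ℝ) = 1 := Sg_zero _ _ _ _ _ _ _
    rw [t0]
    simpa [Hm, Zm] using h
  | succ m => exact (high j a c α y he hf m hm he' hf').2

theorem Sl_trunc (m i : ℕ) (a c y : ℝ) :
    Sl (m + i) a c y ((m + i + 1 + m : ℕ) : ℝ) =
      Sg a (-((m + i : ℕ) : ℝ)) (a + c) (a - c - (m + i : ℕ)) (-(2 * (m + i : ℕ) + 1)) y i
        ((m + i + 1 + m : ℕ) : ℝ) := by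
  have h := Sg_ext a (-((m + i : ℕ) : ℝ)) (a + c) (a - c - (m + i : ℕ))
    (-(2 * (m + i : ℕ) + 1)) y ((m + i + 1 + m : ℕ) : ℝ) i m (by
      intro k hk
      rw [cf_symm _ _ _ _ (i : ℝ) _ (by push_cast; ring)]
      exact cf_zero_left _ _ _ _ hk)
  rw [← h, add_comm i m]
  rfl

theorem sgn_sq (k : ℕ) : ((-1 : ℝ) ^ k) * (-1) ^ k = 1 := by rw [← mul_pow]; simp

theorem fact_two (m : ℕ) : ((2 * (m + 1)).factorial : ℝ) =
    (2 * m + 2) * ((2 * m + 1) * (2 * m).factorial) := by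
  rw [show 2 * (m + 1) = 2 * m + 1 + 1 by ring, Nat.factorial_succ, Nat.factorial_succ]
  push_cast; ring

theorem Hm_aux (j : ℕ) (a c α : ℝ) (m i : ℕ) (hj : j = m + i) :
    Hm j a c α m * (i.factorial * (2 * m).factorial) =
      α * (-1) ^ (j + 1) * j.factorial * m.factorial * poch (a + c) (j + 1 + m) *
        poch (a - c - j) (j + 1 + m) := by
  induction m generalizing i with
  | zero =>
    have := et_top j a c
    have hi : i = j := by omega
    subst hi
    simp [Hm, H0, poch_succ, pow_succ]
    linear_combination (α * (a - c) * (a + c + i) * i.factorial) * this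
  | succ m ih =>
    have ih := ih (i + 1) (by omega)
    rw [Hm_succ, fact_two, show j + 1 + (m + 1) = j + 1 + m + 1 by ring, poch_succ,
      poch_succ (a - c - j), Nat.factorial_succ m]
    rw [Nat.factorial_succ i] at ih
    have hp : pl j a c ((j + 1 + m : ℕ) : ℝ) * (2 * (2 * m + 1)) =
        (a + c + (j + 1 + m : ℕ)) * (a - c - j + (j + 1 + m : ℕ)) * (i + 1) := by
      unfold pl pA
      have h1 : 2 * ((j + 1 + m : ℕ) : ℝ) + -(2 * j + 1) = 2 * m + 1 := by push_cast; ring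
      have h2 : ((j + 1 + m : ℕ) : ℝ) + -(2 * j + 1) = -((i : ℝ) + 1) := by
        rw [hj]; push_cast; ring
      have h3 : (2 * (m : ℝ) + 1) ≠ 0 := by positivity
      rw [h1, h2]
      field_simp
      ring
    push_cast at *
    linear_combination (Hm j a c α m * i.factorial * (m + 1) * (2 * m).factorial) * hp +
      (m + 1) * (a + c + (j + 1 + m)) * (a - c - j + (j + 1 + m)) * ih

theorem Hm_closed (m i : ℕ) (a c α : ℝ) : Hm (m + i) a c α m =
    α * poch 1 (m + i + 1 + m) * poch (-((m + i : ℕ) : ℝ)) (m + i) * poch 1 m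
        * poch (a + c) (m + i + 1 + m) * poch (a - c - (m + i : ℕ)) (m + i + 1 + m) /
      (poch (-((m + i + 1 + m : ℕ) : ℝ)) (m + i + 1 + m)
        * poch (((m + i + 1 + m : ℕ) : ℝ) - (2 * ((m + i : ℕ) : ℝ) + 1)) i * poch 1 (2 * m)) := by
  have e1 : ((m + i + 1 + m : ℕ) : ℝ) - (2 * ((m + i : ℕ) : ℝ) + 1) = -(i : ℝ) := by
    push_cast; ring
  have h := Hm_aux (m + i) a c α m i rfl
  rw [e1]
  simp only [poch_one, poch_neg_self]
  rw [eq_div_iff (by positivity)]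
  have hs1 := sgn_sq m
  have hs2 := sgn_sq i
  simp only [pow_add, pow_one] at *
  generalize (-1 : ℝ) ^ m = s at *
  generalize (-1 : ℝ) ^ i = t at *
  generalize ((m + i + 1 + m).factorial : ℝ) = F at *
  linear_combination (s * t * (-1) * s * F * t) * h +
    (F * α * (m + i).factorial * m.factorial * poch (a + c) (m + i + 1 + m) *
      poch (a - c - (m + i : ℕ)) (m + i + 1 + m) * s * t ^ 3) * hs1 +
    (F * α * (m + i).factorial * m.factorial * poch (a + c) (m + i + 1 + m) *
      poch (a - c - (m + i : ℕ)) (m + i + 1 + m) * s * t) * hs2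

theorem Zm_aux (j : ℕ) (a c : ℝ) (m : ℕ) :
    Zm j a c m * ((2 * m).factorial * (j + 1).factorial * (poch (a + c) (j + 1) *
      poch (a - c - j) (j + 1))) =
      (-1) ^ m * (j + 1 + m).factorial * m.factorial * poch (a + c) (j + 1 + m) *
        poch (a - c - j) (j + 1 + m) := by
  induction m with
  | zero => simp [Zm]; ring
  | succ m ih =>
    rw [Zm_succ, fact_two, show j + 1 + (m + 1) = j + 1 + m + 1 by ring, poch_succ _ (j + 1 + m),
      poch_succ (a - c - j) (j + 1 + m), Nat.factorial_succ m, Nat.factorial_succ (j + 1 + m)]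
    have hp : ph j a c m * (2 * (2 * m + 1)) =
        -((j + 1 + m : ℕ) + 1) * (a + c + (j + 1 + m : ℕ)) * (a - c - j + (j + 1 + m : ℕ)) := by
      unfold ph pB
      have h3 : (2 * (m : ℝ) + 1) ≠ 0 := by positivity
      push_cast
      field_simp
      ring
    push_cast at *
    linear_combination (Zm j a c m * (m + 1) * (2 * m).factorial * (j + 1).factorial *
      (poch (a + c) (j + 1) * poch (a - c - j) (j + 1))) * hp +
      (m + 1) * (-((j + 1 + m) + 1) * (a + c + (j + 1 + m)) * (a - c - j + (j + 1 + m))) * ih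

theorem coef_closed (m i : ℕ) (a c α : ℝ) (hα : α ≠ 0) (he : poch (a + c) (m + i + 1) ≠ 0)
    (hf : poch (a - c - (m + i : ℕ)) (m + i + 1) ≠ 0) :
    α * poch 1 (m + i + 1 + m) * poch (-((m + i : ℕ) : ℝ)) (m + i) * poch 1 m
        * poch (a + c) (m + i + 1 + m) * poch (a - c - (m + i : ℕ)) (m + i + 1 + m) /
      (poch (-((m + i + 1 + m : ℕ) : ℝ)) (m + i + 1 + m)
        * poch (((m + i + 1 + m : ℕ) : ℝ) - (2 * ((m + i : ℕ) : ℝ) + 1)) i * poch 1 (2 * m)) *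
    (poch (-((m + i + 1 + m : ℕ) : ℝ)) (m + i + 1)
        * poch (((m + i + 1 + m : ℕ) : ℝ) - (2 * ((m + i : ℕ) : ℝ) + 1)) i * poch 1 m /
      (α * poch 1 (m + i + 1) * poch (-((m + i : ℕ) : ℝ)) (m + i) * poch (a + c) (m + i + 1)
        * poch (a - c - (m + i : ℕ)) (m + i + 1))) = Zm (m + i) a c m := by
  have e1 : ((m + i + 1 + m : ℕ) : ℝ) - (2 * ((m + i : ℕ) : ℝ) + 1) = -(i : ℝ) := by
    push_cast; ring
  have h := Zm_aux (m + i) a c m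
  have hk : poch (-((m + i + 1 + m : ℕ) : ℝ)) (m + i + 1 + m) =
      poch (-((m + i + 1 + m : ℕ) : ℝ)) (m + i + 1) * poch (-(m : ℝ)) m := by
    rw [poch_add]; congr 2; push_cast; ring
  have hk0 : poch (-((m + i + 1 + m : ℕ) : ℝ)) (m + i + 1) ≠ 0 := poch_neg_ne (by omega)
  rw [hk, e1]
  have hi0 : poch (-(i : ℝ)) i ≠ 0 := poch_neg_ne le_rfl
  have hj0 : poch (-((m + i : ℕ) : ℝ)) (m + i) ≠ 0 := poch_neg_ne le_rfl
  rw [poch_neg_self m]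
  simp only [poch_one]
  generalize poch (-((m + i + 1 + m : ℕ) : ℝ)) (m + i + 1) = A at *
  generalize poch (-(i : ℝ)) i = B at *
  generalize poch (-((m + i : ℕ) : ℝ)) (m + i) = D at *
  have hs := sgn_sq m
  rw [div_mul_div_comm, div_eq_iff (by positivity)]
  linear_combination (-α * m.factorial * D * A * B * (-1) ^ m) * h + (-(α * (m + i + 1 + m).factorial * D *
      m.factorial ^ 2 * poch (a + c) (m + i + 1 + m) *
      poch (a - c - (m + i : ℕ)) (m + i + 1 + m) * A * B)) * hs
theorem paraRacahOdd_explicit_high (j : ℕ) (a c α : ℝ) (n : ℕ)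
    (hjn : j < n) (hn : n ≤ 2 * j + 1) (hα : α ≠ 0)
    (h₁ : poch (a + c) n ≠ 0) (h₂ : poch (a - c - j) n ≠ 0)
    (h₃ : poch (a - c + 1) (n - j - 1) ≠ 0) (h₄ : poch (a + c + j + 1) (n - j - 1) ≠ 0) :
    ∀ y : ℝ, (paraRacahOdd j a c α n).eval y =
      (α * poch 1 n * poch (-(j : ℝ)) j * poch 1 (n - j - 1) * poch (a + c) n
            * poch (a - c - j) n /
          (poch (-(n : ℝ)) n * poch ((n : ℝ) - (2 * j + 1)) (2 * j + 1 - n)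
            * poch 1 (2 * n - 1 - (2 * j + 1)))) *
        (∑ k ∈ Finset.range (2 * j + 1 - n + 1),
            poch (-(n : ℝ)) k * poch ((n : ℝ) - (2 * j + 1)) k /
                (poch 1 k * poch (-(j : ℝ)) k * poch (a + c) k * poch (a - c - j) k) *
              ∏ l ∈ Finset.range k, ((a + l) ^ 2 + y)) +
      (α * poch 1 n * poch (-(j : ℝ)) j * poch 1 (n - j - 1) * poch (a + c) n
            * poch (a - c - j) n /
          (poch (-(n : ℝ)) n * poch ((n : ℝ) - (2 * j + 1)) (2 * j + 1 - n)
            * poch 1 (2 * n - 1 - (2 * j + 1)))) *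
        (poch (-(n : ℝ)) (j + 1) * poch ((n : ℝ) - (2 * j + 1)) (2 * j + 1 - n)
            * poch 1 (n - j - 1) /
          (α * poch 1 (j + 1) * poch (-(j : ℝ)) j * poch (a + c) (j + 1)
            * poch (a - c - j) (j + 1))) *
        (∏ l ∈ Finset.range (j + 1), ((a + l) ^ 2 + y)) *
        ∑ m ∈ Finset.range (n - j - 1 + 1),
          poch (-(n : ℝ) + j + 1) m * poch ((n : ℝ) - j) m /
              (poch 1 m * poch ((j : ℝ) + 2) m * poch (a + c + j + 1) m * poch (a - c + 1) m) *
            ∏ l ∈ Finset.range m, ((a + j + 1 + l) ^ 2 + y) := by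
  intro y
  obtain ⟨m, rfl⟩ : ∃ m, n = j + 1 + m := ⟨n - (j + 1), by omega⟩
  obtain ⟨i, rfl⟩ : ∃ i, j = m + i := ⟨j - m, by omega⟩
  have s1 : m + i + 1 + m - (m + i) - 1 = m := by omega
  have s2 : 2 * (m + i) + 1 - (m + i + 1 + m) = i := by omega
  have s3 : 2 * (m + i + 1 + m) - 1 - (2 * (m + i) + 1) = 2 * m := by omega
  rw [s1] at h₃ h₄
  rw [s1, s2, s3]
  have he : poch (a + c) (m + i + 1) ≠ 0 := poch_ne_of_le (by omega) h₁
  have hf : poch (a - c - (m + i : ℕ)) (m + i + 1) ≠ 0 := poch_ne_of_le (by omega) h₂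
  have main := high_all (m + i) a c α y (poch_ne_of_le (by omega) h₁)
    (poch_ne_of_le (by omega) h₂) m (by omega) h₄ h₃
  have hS := Sl_trunc m i a c y
  rw [Hm_closed m i a c α, hS] at main
  have hc := coef_closed m i a c α hα he hf
  rw [hc]
  refine main.trans ?_
  have n1 : ((m + i + 1 + m : ℕ) : ℝ) - (2 * ((m + i : ℕ) : ℝ) + 1) =
    ((m + i + 1 + m : ℕ) : ℝ) + -(2 * ((m + i : ℕ) : ℝ) + 1) := by ring
  have n2 : -((m + i + 1 + m : ℕ) : ℝ) + ((m + i : ℕ) : ℝ) + 1 = -(m : ℝ) := by push_cast; ring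
  have n3 : ((m + i + 1 + m : ℕ) : ℝ) - ((m + i : ℕ) : ℝ) = (m : ℝ) + 1 := by push_cast; ring
  rw [n2, n3, n1]
  rfl
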